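/- arXiv:1309.6351 — 2 statements merged into one kernel-verified Lean document; each statement's English description precedes it below -/
import Mathlib

section
/- Let I be a square-free monomial ideal of S containing no variable. Assume that for some integer s ≥ 1 the ideal I^s has linear quotients with respect to the restriction of a monomial order on S to G(I^s). Then I satisfies the strong gcd condition. -/
open MvPolynomial

/-- The monomial ideal of `MvPolynomial (Fin n) K` generated by the monomials
whose exponent vectors lie in `A`. -/
noncomputable def mIdeal (K : Type) [Field K] {n : ℕ} (A : Set (Fin n →₀ ℕ)) :
    Ideal (MvPolynomial (Fin n) K) :=
  Ideal.span ((fun a => monomial a (1 : K)) '' A)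

/-- `G` is the (unique) minimal set of monomial generators of the monomial ideal `I`:
the monomials with exponent vectors in `G` generate `I`, and `G` is an antichain with
respect to divisibility of monomials (i.e. the pointwise order on exponent vectors). -/
def IsMinGen (K : Type) [Field K] {n : ℕ} (G : Finset (Fin n →₀ ℕ))
    (I : Ideal (MvPolynomial (Fin n) K)) : Prop :=
  I = mIdeal K (↑G : Set (Fin n →₀ ℕ)) ∧ ∀ a ∈ G, ∀ b ∈ G, a ≤ b → a = b

/-- `r` is (the strict order of) a monomial order on `K[x_1,…,x_n]`, viewed on exponent
vectors (so multiplication of monomials is addition of exponent vectors): a strict linear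
order such that the monomial `1` (exponent vector `0`) is smallest and which is compatible
with multiplication. -/
def IsMonomialOrder {n : ℕ} (r : (Fin n →₀ ℕ) → (Fin n →₀ ℕ) → Prop) : Prop :=
  (∀ a b c, r a b → r b c → r a c) ∧
  (∀ a b, a ≠ b → r a b ∨ r b a) ∧
  (∀ a, ¬ r a a) ∧
  (∀ a, a ≠ 0 → r 0 a) ∧
  (∀ a b c, r a b → r (a + c) (b + c))

/-- The ideal `J` is generated by a subset of the variables `x_1,…,x_n`. -/
def GenByVars (K : Type) [Field K] {n : ℕ} (J : Ideal (MvPolynomial (Fin n) K)) : Prop :=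
  ∃ V : Set (Fin n), J = Ideal.span ((fun i => (X i : MvPolynomial (Fin n) K)) '' V)

/-- The monomial ideal with minimal monomial generators `G` has linear quotients with
respect to the linear order `r` on `G`: for every generator `u`, the colon ideal of the
ideal generated by the generators preceding `u` by `u` is generated by a subset of the
variables.  (For the `r`-smallest generator this colon ideal is the zero ideal, which is
generated by the empty subset of variables, so the condition is vacuous there.) -/
noncomputable def HasLinearQuotients (K : Type) [Field K] {n : ℕ}
    (G : Finset (Fin n →₀ ℕ)) (r : (Fin n →₀ ℕ) → (Fin n →₀ ℕ) → Prop) : Prop :=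
  ∀ u ∈ G, GenByVars K
    ((mIdeal K {v | v ∈ G ∧ r v u}).colon (Ideal.span {monomial u (1 : K)}))

open scoped Pointwise

section MonomialIdeals

variable {K : Type} [Field K] {n : ℕ}

lemma monomial_mem_mIdeal {A : Set (Fin n →₀ ℕ)} {b : Fin n →₀ ℕ} :
    monomial b (1 : K) ∈ mIdeal K A ↔ ∃ a ∈ A, a ≤ b := by
  classical
  rw [mIdeal, mem_ideal_span_monomial_image]
  simp [support_monomial]

lemma mIdeal_mul (A B : Set (Fin n →₀ ℕ)) :
    mIdeal K A * mIdeal K B = mIdeal K (A + B) := by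
  rw [mIdeal, mIdeal, mIdeal, Ideal.span_mul_span']
  congr 1
  ext p
  simp only [Set.mem_mul, Set.mem_image, Set.mem_add]
  constructor
  · rintro ⟨_, ⟨a, ha, rfl⟩, _, ⟨b, hb, rfl⟩, rfl⟩
    exact ⟨a + b, ⟨a, ha, b, hb, rfl⟩, by simp [monomial_mul]⟩
  · rintro ⟨_, ⟨a, ha, b, hb, rfl⟩, rfl⟩
    exact ⟨_, ⟨a, ha, rfl⟩, _, ⟨b, hb, rfl⟩, by simp [monomial_mul]⟩

lemma mIdeal_pow (A : Set (Fin n →₀ ℕ)) (s : ℕ) :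
    mIdeal K A ^ s = mIdeal K (s • A) := by
  induction s with
  | zero => simp [mIdeal, Ideal.one_eq_top]
  | succ s ih => rw [pow_succ, ih, mIdeal_mul, succ_nsmul]

lemma IsMinGen.subset_of_eq_mIdeal {Gs : Finset (Fin n →₀ ℕ)}
    {J : Ideal (MvPolynomial (Fin n) K)} (hGs : IsMinGen K Gs J)
    {A : Set (Fin n →₀ ℕ)} (hJ : J = mIdeal K A) : (Gs : Set (Fin n →₀ ℕ)) ⊆ A := by
  have h : mIdeal K A = mIdeal K (Gs : Set (Fin n →₀ ℕ)) := hJ.symm.trans hGs.1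
  intro b hb
  obtain ⟨a, ha, hab⟩ := monomial_mem_mIdeal.1
    (h.symm ▸ monomial_mem_mIdeal.2 ⟨b, hb, le_rfl⟩ : monomial b (1 : K) ∈ mIdeal K A)
  obtain ⟨c, hc, hca⟩ := monomial_mem_mIdeal.1
    (h ▸ monomial_mem_mIdeal.2 ⟨a, ha, le_rfl⟩ :
      monomial a (1 : K) ∈ mIdeal K (Gs : Set (Fin n →₀ ℕ)))
  have hcb := hGs.2 c hc b hb (hca.trans hab)
  rwa [le_antisymm (hcb ▸ hca) hab]

/-- If the colon ideal is generated by variables and `w` precedes `v`, then some variable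
dividing the monomial `w` lies in the colon ideal. -/
lemma GenByVars.exists_le_add_single {A : Set (Fin n →₀ ℕ)} {v w : Fin n →₀ ℕ}
    (h : GenByVars K ((mIdeal K A).colon (Ideal.span {monomial v (1 : K)}))) (hw : w ∈ A) :
    ∃ i, w i ≠ 0 ∧ ∃ b ∈ A, b ≤ v + Finsupp.single i 1 := by
  classical
  obtain ⟨V, hV⟩ := h
  have hmem : monomial w (1 : K) ∈
      (mIdeal K A).colon (Ideal.span {monomial v (1 : K)}) := by
    rw [Ideal.mem_colon_span_singleton, monomial_mul, one_mul]
    exact monomial_mem_mIdeal.2 ⟨w, hw, le_self_add⟩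
  rw [hV, mem_ideal_span_X_image] at hmem
  obtain ⟨i, hiV, hi⟩ := hmem w (by simp [support_monomial])
  refine ⟨i, hi, ?_⟩
  have hX : (X i : MvPolynomial (Fin n) K) ∈
      (mIdeal K A).colon (Ideal.span {monomial v (1 : K)}) := by
    rw [hV]
    exact Ideal.subset_span ⟨i, hiV, rfl⟩
  rw [Ideal.mem_colon_span_singleton, X, monomial_mul, one_mul, add_comm] at hX
  exact monomial_mem_mIdeal.1 hX

end MonomialIdeals

section SquareFree

variable {n : ℕ} {G : Set (Fin n →₀ ℕ)}

lemma eq_nsmul_of_mem_nsmul (hsf : ∀ a ∈ G, ∀ i, a i ≤ 1)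
    (hanti : ∀ a ∈ G, ∀ b ∈ G, a ≤ b → a = b) {v : Fin n →₀ ℕ} (hv : v ∈ G) {s : ℕ}
    {b : Fin n →₀ ℕ} (hb : b ∈ s • G) (hsupp : ∀ j, v j = 0 → b j = 0) : b = s • v := by
  induction s generalizing b with
  | zero => simpa using hb
  | succ s ih =>
    rw [succ_nsmul] at hb
    obtain ⟨c, hc, g, hg, rfl⟩ := hb
    have hsum : ∀ j, v j = 0 → c j = 0 ∧ g j = 0 := by simpa using hsupp
    obtain rfl := hanti g hg v hv fun j => by
      have := hsf g hg j
      have := hsum j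
      lia
    rw [succ_nsmul, ← ih hc fun j hj => (hsum j hj).1]

/-- An `s`-fold product of generators whose part prime to `v` divides `x_i` is `v ^ s` or
`w v ^ (s - 1)` for a generator `w` dividing `x_i v`. -/
lemma eq_nsmul_or_exists_le_add_single (hsf : ∀ a ∈ G, ∀ i, a i ≤ 1)
    (hanti : ∀ a ∈ G, ∀ b ∈ G, a ≤ b → a = b) {v : Fin n →₀ ℕ} (hv : v ∈ G)
    {i : Fin n} {s : ℕ} {b : Fin n →₀ ℕ} (hb : b ∈ s • G)
    (hle : ∀ j, v j = 0 → b j ≤ Finsupp.single i 1 j) :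
    b = s • v ∨ ∃ w ∈ G, w ≤ v + Finsupp.single i 1 ∧ b + v = w + s • v := by
  induction s generalizing b with
  | zero => exact Or.inl (by simpa using hb)
  | succ s ih =>
    rw [succ_nsmul] at hb
    obtain ⟨c, hc, g, hg, rfl⟩ := hb
    have hsum : ∀ j, v j = 0 → c j + g j ≤ Finsupp.single i 1 j := by simpa using hle
    have hgsf := hsf g hg
    by_cases hgv : g ≤ v
    · obtain rfl := hanti g hg v hv hgv
      rcases ih hc fun j hj => (Nat.le_add_right _ _).trans (hsum j hj) with
        rfl | ⟨w, hw, hwle, hbw⟩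
      · exact Or.inl (succ_nsmul _ _).symm
      · refine Or.inr ⟨w, hw, hwle, ?_⟩
        change c + g + g = _
        rw [hbw, succ_nsmul, add_assoc]
    · obtain ⟨k, hk⟩ : ∃ k, ¬ g k ≤ v k := by simpa [Finsupp.le_def] using hgv
      have hvk : v k = 0 := by have := hgsf k; lia
      obtain rfl : i = k := by
        by_contra hne
        have := hsum k hvk
        rw [Finsupp.single_apply, if_neg hne] at this
        lia
      obtain rfl := eq_nsmul_of_mem_nsmul hsf hanti hv hc fun j hj => by
        have := hsum j hj
        rw [Finsupp.single_apply] at this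
        split_ifs at this with hij
        · subst hij
          lia
        · lia
      refine Or.inr ⟨g, hg, fun j => ?_, ?_⟩
      · have := hgsf j
        have := hsum j
        rw [Finsupp.add_apply]
        lia
      · change s • v + g + v = _
        rw [succ_nsmul, add_right_comm, add_comm]

end SquareFree

/-- Let `I` be a square-free monomial ideal of `S = K[x_1,…,x_n]` containing no variable,
with minimal monomial generating set `G`.  If for some `s ≥ 1` the ideal `I^s` has linear
quotients with respect to the restriction of a monomial order `r` on `S` to `G(I^s)`,
then `I` satisfies the strong gcd condition: there is a linear order `p` on `G(I)` such
that for any `u ≺ v` in `G(I)` with `gcd(u,v) = 1` there is `w ∈ G(I)` with `w ≠ u`,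
`w ≠ v`, `u ≺ w` and `w ∣ uv` (on exponent vectors: `w ≤ u + v`). -/
theorem powers_linear_quotients_strong_gcd_condition
    {K : Type} [Field K] {n : ℕ}
    (I : Ideal (MvPolynomial (Fin n) K)) (G Gs : Finset (Fin n →₀ ℕ))
    (hsf : ∀ a ∈ G, ∀ i, a i ≤ 1)
    (s : ℕ) (hs : 1 ≤ s)
    (hG : IsMinGen K G I) (hGs : IsMinGen K Gs (I ^ s))
    (hnovar : ∀ i : Fin n, Finsupp.single i 1 ∉ G)
    (r : (Fin n →₀ ℕ) → (Fin n →₀ ℕ) → Prop) (hr : IsMonomialOrder r)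
    (hlq : HasLinearQuotients K Gs r) :
    ∃ p : (Fin n →₀ ℕ) → (Fin n →₀ ℕ) → Prop,
      (∀ a ∈ G, ¬ p a a) ∧
      (∀ a ∈ G, ∀ b ∈ G, ∀ c ∈ G, p a b → p b c → p a c) ∧
      (∀ a ∈ G, ∀ b ∈ G, a ≠ b → p a b ∨ p b a) ∧
      (∀ u ∈ G, ∀ v ∈ G, p u v → u ⊓ v = 0 →
        ∃ w ∈ G, w ≠ u ∧ w ≠ v ∧ p u w ∧ w ≤ u + v) := by
  have hG2 := hG.2
  obtain ⟨htrans, htot, hirr, -, hadd⟩ := hr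
  have hpow : I ^ s = mIdeal K (s • (G : Set (Fin n →₀ ℕ))) := by rw [hG.1, mIdeal_pow]
  have hsub := hGs.subset_of_eq_mIdeal hpow
  have hnsmul_mem : ∀ v ∈ G, s • v ∈ Gs := by
    intro v hv
    have hmem : monomial (s • v) (1 : K) ∈ mIdeal K (Gs : Set (Fin n →₀ ℕ)) := by
      rw [← hGs.1, hpow]
      exact monomial_mem_mIdeal.2 ⟨s • v, Set.nsmul_mem_nsmul hv, le_rfl⟩
    obtain ⟨c, hc, hcv⟩ := monomial_mem_mIdeal.1 hmem
    rwa [← eq_nsmul_of_mem_nsmul hsf hG2 hv (hsub hc) fun j hj => ?_]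
    simpa [hj] using hcv j
  have hr_nsmul : ∀ a b, r a b → ∀ m : ℕ, r ((m + 1) • a) ((m + 1) • b) := by
    intro a b hab m
    induction m with
    | zero => simpa using hab
    | succ m ih =>
      rw [succ_nsmul a, succ_nsmul b]
      have h := hadd a b ((m + 1) • b) hab
      rw [add_comm a, add_comm b] at h
      exact htrans _ _ _ (hadd _ _ a ih) h
  have hr_cancel : ∀ a b c, r (a + c) (b + c) → r a b := by
    intro a b c h
    by_contra hab
    rcases eq_or_ne a b with rfl | hne
    · exact hirr _ h
    · exact hirr _ (htrans _ _ _ h (hadd _ _ c ((htot a b hne).resolve_left hab)))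
  refine ⟨fun a b => r b a, fun a _ => hirr a, fun a _ b _ c _ hab hbc => htrans _ _ _ hbc hab,
    fun a _ b _ hab => (htot a b hab).symm, fun v hv u hu huv hdisj => ?_⟩
  have hlt : r (s • u) (s • v) := by
    obtain ⟨m, rfl⟩ := Nat.exists_eq_add_of_le' hs
    exact hr_nsmul u v huv m
  obtain ⟨i, hi, b, ⟨hbGs, hbv⟩, hb⟩ :=
    (hlq _ (hnsmul_mem v hv)).exists_le_add_single (w := s • u) ⟨hnsmul_mem u hu, hlt⟩
  have hui : u i ≠ 0 := fun h => hi (by simp [h])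
  have hmin : ∀ j, min (v j) (u j) = 0 := fun j => DFunLike.congr_fun hdisj j
  rcases eq_nsmul_or_exists_le_add_single hsf hG2 hv (hsub hbGs)
    (fun j hj => by simpa [hj] using hb j) with rfl | ⟨w, hw, hwle, hbw⟩
  · exact absurd hbv (hirr _)
  have hwv : r w v := by
    have h := hadd _ _ v hbv
    rw [hbw, add_comm (s • v)] at h
    exact hr_cancel _ _ _ h
  refine ⟨w, hw, ?_, ?_, hwv, hwle.trans ?_⟩
  · rintro rfl
    exact hirr _ hwv
  · rintro rfl
    refine hnovar i ?_
    convert hu using 1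
    ext j
    have h1 := hwle j
    have h2 := hmin j
    rcases eq_or_ne i j with rfl | hj
    · have := hsf w hu i
      simp
      lia
    · simp [hj] at h1 ⊢
      lia
  · gcongr
    rw [Finsupp.single_le_iff]
    lia
end

section
/- Let G be a finite simple graph on vertex set {v_1,…,v_n} with edge ideal I(G) ⊆ S. If for some integer s ≥ 1 the ideal I(G)^s has linear quotients with respect to the restriction of a monomial order on S to G(I(G)^s), then the complementary graph G^c has no induced 4-cycle. -/
open MvPolynomial

/-- The edge ideal of a finite simple graph on vertices `{1,…,n}`: the ideal of
`K[x_1,…,x_n]` generated by the monomials `x_i x_j` with `{i,j}` an edge of `G`. -/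
noncomputable def edgeIdeal (K : Type) [Field K] {n : ℕ} (G : SimpleGraph (Fin n)) :
    Ideal (MvPolynomial (Fin n) K) :=
  Ideal.span {m | ∃ i j, G.Adj i j ∧ m = X i * X j}

/-- The exponent vectors of the `s`-fold products of edge monomials of `G`. -/
def edgePowerExponents {n : ℕ} (G : SimpleGraph (Fin n)) : ℕ → Set (Fin n →₀ ℕ)
  | 0 => {0}
  | s + 1 => {w | ∃ v ∈ edgePowerExponents G s, ∃ i j, G.Adj i j ∧
      w = v + (Finsupp.single i 1 + Finsupp.single j 1)}

theorem edgeIdeal_pow_eq_mIdeal (K : Type) [Field K] {n : ℕ} (G : SimpleGraph (Fin n)) (s : ℕ) :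
    edgeIdeal K G ^ s = mIdeal K (edgePowerExponents G s) := by
  induction s with
  | zero => simp [mIdeal, edgePowerExponents, Ideal.one_eq_top]
  | succ s ih =>
    rw [pow_succ, ih, mIdeal, edgeIdeal, Ideal.span_mul_span', mIdeal]
    congr 1
    ext p
    simp only [Set.mem_mul, Set.mem_image, Set.mem_ofPred_eq, edgePowerExponents]
    constructor
    · rintro ⟨_, ⟨v, hv, rfl⟩, _, ⟨i, j, hij, rfl⟩, rfl⟩
      exact ⟨_, ⟨v, hv, i, j, hij, rfl⟩, by simp [X, monomial_mul]⟩
    · rintro ⟨_, ⟨v, hv, i, j, hij, rfl⟩, rfl⟩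
      exact ⟨_, ⟨v, hv, rfl⟩, _, ⟨i, j, hij, rfl⟩, by simp [X, monomial_mul]⟩

theorem monomial_mem_mIdeal_iff (K : Type) [Field K] {n : ℕ} (A : Set (Fin n →₀ ℕ))
    (v : Fin n →₀ ℕ) : monomial v (1 : K) ∈ mIdeal K A ↔ ∃ w ∈ A, w ≤ v := by
  classical
  simp [mIdeal, mem_ideal_span_monomial_image, support_monomial]

theorem degree_of_mem_edgePowerExponents {n : ℕ} {G : SimpleGraph (Fin n)} {s : ℕ}
    {v : Fin n →₀ ℕ} (hv : v ∈ edgePowerExponents G s) : v.degree = 2 * s := by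
  induction s generalizing v with
  | zero => simp_all [edgePowerExponents]
  | succ s ih =>
    obtain ⟨w, hw, i, j, -, rfl⟩ := hv
    simp [ih hw, mul_add]

theorem eq_of_le_of_degree_eq {n : ℕ} {v w : Fin n →₀ ℕ} (h : v ≤ w)
    (hd : v.degree = w.degree) : v = w := by
  obtain ⟨t, rfl⟩ := exists_add_of_le h
  have ht : t.degree = 0 := by
    rw [map_add] at hd
    omega
  rw [(Finsupp.degree_eq_zero_iff t).1 ht, add_zero]

theorem IsMinGen.mem_iff_mem_edgePowerExponents {K : Type} [Field K] {n : ℕ}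
    {G : SimpleGraph (Fin n)} {s : ℕ} {Gs : Finset (Fin n →₀ ℕ)}
    (h : IsMinGen K Gs (edgeIdeal K G ^ s)) {v : Fin n →₀ ℕ} :
    v ∈ Gs ↔ v ∈ edgePowerExponents G s := by
  have key (x : Fin n →₀ ℕ) :
      (∃ w ∈ edgePowerExponents G s, w ≤ x) ↔ ∃ g ∈ (Gs : Set (Fin n →₀ ℕ)), g ≤ x := by
    rw [← monomial_mem_mIdeal_iff K, ← monomial_mem_mIdeal_iff K, ← edgeIdeal_pow_eq_mIdeal, h.1]
  have sub {x : Fin n →₀ ℕ} (hx : x ∈ Gs) : x ∈ edgePowerExponents G s := by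
    obtain ⟨w, hw, hwx⟩ := (key x).2 ⟨x, hx, le_rfl⟩
    obtain ⟨g, hg, hgw⟩ := (key w).1 ⟨w, hw, le_rfl⟩
    obtain rfl := h.2 g hg x hx (hgw.trans hwx)
    rwa [le_antisymm hgw hwx]
  refine ⟨sub, fun hv => ?_⟩
  obtain ⟨g, hg, hgv⟩ := (key v).1 ⟨v, hv, le_rfl⟩
  rwa [← eq_of_le_of_degree_eq hgv ((degree_of_mem_edgePowerExponents (sub hg)).trans
    (degree_of_mem_edgePowerExponents hv).symm)]

theorem nsmul_edge_mem_edgePowerExponents {n : ℕ} {G : SimpleGraph (Fin n)} {i j : Fin n}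
    (h : G.Adj i j) (s : ℕ) :
    s • (Finsupp.single i 1 + Finsupp.single j 1) ∈ edgePowerExponents G s := by
  induction s with
  | zero => simp [edgePowerExponents]
  | succ s ih => exact ⟨_, ih, i, j, h, succ_nsmul _ _⟩

/-- If `a, b, c, d` is an induced 4-cycle of the complement of `G`, the only `s`-fold products of
edges supported on it are the products of powers of `x_a x_c` and `x_b x_d`. -/
theorem exists_of_mem_edgePowerExponents {n : ℕ} {G : SimpleGraph (Fin n)} {a b c d : Fin n}
    (hab : ¬ G.Adj a b) (hbc : ¬ G.Adj b c) (hcd : ¬ G.Adj c d) (hda : ¬ G.Adj d a)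
    {s : ℕ} {v : Fin n →₀ ℕ} (hv : v ∈ edgePowerExponents G s)
    (hsupp : ∀ i, v i ≠ 0 → i = a ∨ i = b ∨ i = c ∨ i = d) :
    ∃ p q, p + q = s ∧ v = p • (Finsupp.single a 1 + Finsupp.single c 1) +
      q • (Finsupp.single b 1 + Finsupp.single d 1) := by
  induction s generalizing v with
  | zero => exact ⟨0, 0, rfl, by simp_all [edgePowerExponents]⟩
  | succ s ih =>
    obtain ⟨w, hw, i, j, hij, rfl⟩ := hv
    obtain ⟨p, q, hpq, rfl⟩ := ih hw fun k hk => hsupp k (by simp [hk])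
    have hi := hsupp i (by simp)
    have hj := hsupp j (by simp)
    have : Finsupp.single i 1 + Finsupp.single j 1 =
          (Finsupp.single a 1 + Finsupp.single c 1 : Fin n →₀ ℕ) ∨
        Finsupp.single i 1 + Finsupp.single j 1 =
          (Finsupp.single b 1 + Finsupp.single d 1 : Fin n →₀ ℕ) := by
      have hji := hij.symm
      rcases hi with rfl | rfl | rfl | rfl <;> rcases hj with rfl | rfl | rfl | rfl <;>
        first
        | exact absurd hij G.irrefl
        | contradiction
        | exact Or.inl rfl
        | exact Or.inr rfl
        | exact Or.inl (add_comm _ _)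
        | exact Or.inr (add_comm _ _)
    rcases this with h | h
    · exact ⟨p + 1, q, by omega, by rw [h, add_nsmul, one_nsmul]; abel⟩
    · exact ⟨p, q + 1, by omega, by rw [h, add_nsmul, one_nsmul]; abel⟩

theorem eq_of_le_add_single {n : ℕ} {a b c d : Fin n}
    (hdist : a ≠ b ∧ a ≠ c ∧ a ≠ d ∧ b ≠ c ∧ b ≠ d ∧ c ≠ d) {p q k l : ℕ} (hsum : k + l = p + q)
    (i : Fin n)
    (hle : k • (Finsupp.single a 1 + Finsupp.single c 1) +
        l • (Finsupp.single b 1 + Finsupp.single d 1) ≤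
      p • (Finsupp.single a 1 + Finsupp.single c 1) +
        q • (Finsupp.single b 1 + Finsupp.single d 1) + Finsupp.single i 1) :
    k = p ∧ l = q := by
  obtain ⟨hab, hac, had, hbc, hbd, hcd⟩ := hdist
  have ha := hle a
  have hb := hle b
  have hc := hle c
  have hd := hle d
  simp only [Finsupp.add_apply, Finsupp.smul_apply, Finsupp.single_apply, smul_eq_mul] at ha hb hc hd
  grind

theorem exists_mem_support_of_linearQuotients {K : Type} [Field K] {n : ℕ}
    {Gs : Finset (Fin n →₀ ℕ)} {r : (Fin n →₀ ℕ) → (Fin n →₀ ℕ) → Prop}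
    (hlq : HasLinearQuotients K Gs r) {u v : Fin n →₀ ℕ} (hu : u ∈ Gs) (hv : v ∈ Gs)
    (hvu : r v u) :
    ∃ i, v i ≠ 0 ∧ ∃ g ∈ Gs, r g u ∧ g ≤ u + Finsupp.single i 1 := by
  classical
  obtain ⟨V, hV⟩ := hlq u hu
  have mem_colon (w : Fin n →₀ ℕ) :
      monomial w (1 : K) ∈ (mIdeal K {v | v ∈ Gs ∧ r v u}).colon
        (Ideal.span {monomial u (1 : K)} : Set _) ↔ ∃ g ∈ Gs, r g u ∧ g ≤ u + w := by
    rw [Submodule.colon_span, Submodule.mem_colon_singleton, smul_eq_mul, monomial_mul, one_mul,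
      monomial_mem_mIdeal_iff]
    simp [and_assoc, add_comm]
  have hvV := (mem_colon v).2 ⟨v, hv, hvu, le_add_self⟩
  rw [hV, mem_ideal_span_X_image] at hvV
  obtain ⟨i, hi, hvi⟩ := hvV v (by simp [support_monomial])
  refine ⟨i, hvi, (mem_colon _).1 ?_⟩
  rw [hV]
  exact Ideal.subset_span ⟨i, hi, rfl⟩

/-- If for some `s ≥ 1` the power `I(G)^s` of the edge ideal of a graph `G` has linear
quotients with respect to the restriction of a monomial order on `S` to `G(I(G)^s)`,
then the complementary graph `G^c` has no induced 4-cycle. -/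
theorem powers_linear_quotients_no_induced_four_cycle_in_complement
    {K : Type} [Field K] {n : ℕ} (G : SimpleGraph (Fin n))
    (s : ℕ) (hs : 1 ≤ s)
    (Gs : Finset (Fin n →₀ ℕ)) (hGs : IsMinGen K Gs ((edgeIdeal K G) ^ s))
    (r : (Fin n →₀ ℕ) → (Fin n →₀ ℕ) → Prop) (hr : IsMonomialOrder r)
    (hlq : HasLinearQuotients K Gs r)
    (a b c d : Fin n)
    (hdist : a ≠ b ∧ a ≠ c ∧ a ≠ d ∧ b ≠ c ∧ b ≠ d ∧ c ≠ d) :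
    ¬ (¬ G.Adj a b ∧ ¬ G.Adj b c ∧ ¬ G.Adj c d ∧ ¬ G.Adj d a ∧ G.Adj a c ∧ G.Adj b d) := by
  rintro ⟨hab, hbc, hcd, hda, hac, hbd⟩
  have key (p q k l : ℕ)
      (hu : p • (Finsupp.single a 1 + Finsupp.single c 1) +
        q • (Finsupp.single b 1 + Finsupp.single d 1) ∈ Gs)
      (hv : k • (Finsupp.single a 1 + Finsupp.single c 1) +
        l • (Finsupp.single b 1 + Finsupp.single d 1) ∈ Gs) (hpq : p + q = s) :
      ¬ r (k • (Finsupp.single a 1 + Finsupp.single c 1) +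
          l • (Finsupp.single b 1 + Finsupp.single d 1))
        (p • (Finsupp.single a 1 + Finsupp.single c 1) +
          q • (Finsupp.single b 1 + Finsupp.single d 1)) := by
    intro hvu
    have supp (k l : ℕ) (i : Fin n) (hi : (k • (Finsupp.single a 1 + Finsupp.single c 1) +
        l • (Finsupp.single b 1 + Finsupp.single d 1) : Fin n →₀ ℕ) i ≠ 0) :
        i = a ∨ i = b ∨ i = c ∨ i = d := by
      contrapose! hi
      obtain ⟨ha, hb, hc, hd⟩ := hi
      simp [ha, hb, hc, hd]
    obtain ⟨i, hi, g, hg, hgu, hle⟩ := exists_mem_support_of_linearQuotients hlq hu hv hvu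
    have hi' := supp k l i hi
    have hgsupp (x : Fin n) (hx : g x ≠ 0) : x = a ∨ x = b ∨ x = c ∨ x = d := by
      by_cases hxi : x = i
      · exact hxi ▸ hi'
      · refine supp p q x fun h0 => hx ?_
        have hgx := hle x
        rw [Finsupp.add_apply, h0, Finsupp.single_eq_of_ne hxi] at hgx
        omega
    obtain ⟨p', q', hs', rfl⟩ := exists_of_mem_edgePowerExponents hab hbc hcd hda
      (hGs.mem_iff_mem_edgePowerExponents.1 hg) hgsupp
    obtain ⟨rfl, rfl⟩ := eq_of_le_add_single hdist (hs'.trans hpq.symm) i hle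
    exact hr.2.2.1 _ hgu
  have hac' := hGs.mem_iff_mem_edgePowerExponents.2 (nsmul_edge_mem_edgePowerExponents hac s)
  have hbd' := hGs.mem_iff_mem_edgePowerExponents.2 (nsmul_edge_mem_edgePowerExponents hbd s)
  have hne : s • (Finsupp.single a 1 + Finsupp.single c 1) ≠
      (s • (Finsupp.single b 1 + Finsupp.single d 1) : Fin n →₀ ℕ) := by
    intro h
    have := DFunLike.congr_fun h a
    simp [hdist.1.symm, hdist.2.1.symm, hdist.2.2.1.symm] at this
    omega
  rcases hr.2.1 _ _ hne with h | h
  · exact key 0 s s 0 (by simpa using hbd') (by simpa using hac') (by simp) (by simpa using h)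
  · exact key s 0 0 s (by simpa using hac') (by simpa using hbd') (by simp) (by simpa using h)
end
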